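/- arXiv:math/0501410 — 2 statements merged into one kernel-verified Lean document; each statement's English description precedes it below -/
import Mathlib

section
/- Let α, β ∈ Φ be roots such that α + β ∈ Φ. If α and β are both compact, or both noncompact, then α + β is a compact root; if one of α, β is compact and the other is noncompact, then α + β is a noncompact root. -/
open scoped InnerProductSpace

open LieAlgebra LieAlgebra.IsKilling LieModule in
/-- For roots `α`, `β` with `α + β` a root, every subspace containing all brackets
`⁅x, y⁆`, `x ∈ 𝔤_α`, `y ∈ 𝔤_β`, contains `𝔤_{α+β}`. -/
theorem rootSpace_add_le_aux
    {L : Type*} [LieRing L] [LieAlgebra ℂ L] [FiniteDimensional ℂ L]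
    [LieAlgebra.IsKilling ℂ L]
    (H : LieSubalgebra ℂ L) [H.IsCartanSubalgebra]
    (α β γ : LieModule.Weight ℂ H L) (hα : α.IsNonZero) (hγ0 : γ.IsNonZero)
    (hγ : (γ : H → ℂ) = α + β) (S : Submodule ℂ L)
    (hS : ∀ x ∈ LieAlgebra.rootSpace H α, ∀ y ∈ LieAlgebra.rootSpace H β, ⁅x, y⁆ ∈ S) :
    (LieAlgebra.rootSpace H γ : Submodule ℂ L) ≤ S := by
  obtain ⟨x, hx, x_ne0⟩ := (chainTop α β).exists_ne_zero
  obtain ⟨h, e, f, isSl2, he, hf⟩ := exists_isSl2Triple_of_weight_isNonZero hα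
  obtain rfl := isSl2.h_eq_coroot hα he hf
  have prim : isSl2.HasPrimitiveVectorWith x (chainLength α β : ℂ) :=
    have := lie_mem_genWeightSpace_of_mem_genWeightSpace he hx
    ⟨x_ne0, (chainLength_smul _ _ hx).symm, by rwa [genWeightSpace_add_chainTop _ _ hα] at this⟩
  have h1 : 1 ≤ chainTopCoeff α β := by
    have := ((rootSpace_zsmul_add_ne_bot_iff α β hα 1).mp (by
      rw [one_smul, ← hγ]; exact γ.2)).1
    exact_mod_cast this
  obtain ⟨n, hn⟩ : ∃ n, chainTopCoeff α β = n + 1 := ⟨_, (Nat.sub_add_cancel h1).symm⟩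
  have hle := chainTopCoeff_le_chainLength α β
  have hy : (toEnd ℂ L L f ^ (n + 1)) x ∈ rootSpace H β := by
    have := toEnd_pow_apply_mem hf hx (n + 1)
    rw [coe_chainTop', hn] at this
    convert this using 2
    simp
  have hexp := prim.lie_e_pow_succ_toEnd_f n
  have hne : ⁅e, (toEnd ℂ L L f ^ (n + 1)) x⁆ ≠ 0 := by
    rw [hexp]
    refine smul_ne_zero (mul_ne_zero (Nat.cast_add_one_ne_zero n) ?_)
      (prim.pow_toEnd_f_ne_zero_of_eq_nat rfl (by omega))
    rw [sub_ne_zero]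
    exact_mod_cast (by omega : chainLength α β ≠ n)
  have hmem : ⁅e, (toEnd ℂ L L f ^ (n + 1)) x⁆ ∈ rootSpace H γ := by
    rw [hγ]
    exact lie_mem_genWeightSpace_of_mem_genWeightSpace he hy
  intro z hz
  obtain ⟨k, rfl⟩ : ∃ k : ℂ, k • ⁅e, (toEnd ℂ L L f ^ (n + 1)) x⁆ = z := by
    simpa using (finrank_eq_one_iff_of_nonzero' ⟨_, hmem⟩ (by simpa using hne)).mp
      (finrank_rootSpace_eq_one _ hγ0) ⟨z, hz⟩
  exact S.smul_mem k (hS _ he _ hy)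

/-- If `α`, `β` and `α + β` are roots, then: if `α`, `β` are both compact or both noncompact,
`α + β` is compact; if one is compact and the other noncompact, `α + β` is noncompact. -/
theorem stmt1
    {L : Type*} [LieRing L] [LieAlgebra ℂ L] [FiniteDimensional ℂ L]
    [LieAlgebra.IsSemisimple ℂ L]
    (K : LieSubalgebra ℂ L) (P : Submodule ℂ L)
    (hdec : IsCompl K.toSubmodule P)
    (hKP : ∀ x ∈ K, ∀ y ∈ P, ⁅x, y⁆ ∈ P)
    (hPP : ∀ x ∈ P, ∀ y ∈ P, ⁅x, y⁆ ∈ K)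
    (H : LieSubalgebra ℂ L) [H.IsCartanSubalgebra] (hHK : H ≤ K)
    (α β : H → ℂ) (hα0 : α ≠ 0) (hα : LieAlgebra.rootSpace H α ≠ ⊥)
    (hβ0 : β ≠ 0) (hβ : LieAlgebra.rootSpace H β ≠ ⊥)
    (hαβ0 : α + β ≠ 0) (hαβ : LieAlgebra.rootSpace H (α + β) ≠ ⊥) :
    (((LieAlgebra.rootSpace H α : Submodule ℂ L) ≤ K.toSubmodule ∧
        (LieAlgebra.rootSpace H β : Submodule ℂ L) ≤ K.toSubmodule) ∨
      ((LieAlgebra.rootSpace H α : Submodule ℂ L) ≤ P ∧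
        (LieAlgebra.rootSpace H β : Submodule ℂ L) ≤ P) →
      (LieAlgebra.rootSpace H (α + β) : Submodule ℂ L) ≤ K.toSubmodule) ∧
    (((LieAlgebra.rootSpace H α : Submodule ℂ L) ≤ K.toSubmodule ∧
        (LieAlgebra.rootSpace H β : Submodule ℂ L) ≤ P) ∨
      ((LieAlgebra.rootSpace H α : Submodule ℂ L) ≤ P ∧
        (LieAlgebra.rootSpace H β : Submodule ℂ L) ≤ K.toSubmodule) →
      (LieAlgebra.rootSpace H (α + β) : Submodule ℂ L) ≤ P) := by
  have hZ : ∀ (χ : H → ℂ) (hχ : LieAlgebra.rootSpace H χ ≠ ⊥), χ ≠ 0 →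
      (⟨χ, hχ⟩ : LieModule.Weight ℂ H L).IsNonZero := fun χ hχ h0 h => h0 h
  have key := rootSpace_add_le_aux H ⟨α, hα⟩ ⟨β, hβ⟩ ⟨α + β, hαβ⟩ (hZ _ _ hα0) (hZ _ _ hαβ0) rfl
  constructor
  · rintro (⟨h1, h2⟩ | ⟨h1, h2⟩)
    · exact key _ fun x hx y hy => K.lie_mem (h1 hx) (h2 hy)
    · exact key _ fun x hx y hy => hPP x (h1 hx) y (h2 hy)
  · rintro (⟨h1, h2⟩ | ⟨h1, h2⟩)
    · exact key _ fun x hx y hy => hKP x (h1 hx) y (h2 hy)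
    · refine key _ fun x hx y hy => ?_
      rw [← lie_skew]
      exact P.neg_mem (hKP y (h2 hy) x (h1 hx))
end

section
/- The function on Φ assigning 0 to each compact root and 1 to each noncompact root extends to a group homomorphism from the root lattice ℤΦ to ℤ/2ℤ. Consequently, no noncompact root of 𝔤 is a ℤ-linear combination of compact roots. -/
open scoped InnerProductSpace

namespace Stmt2Aux

open LieAlgebra LieAlgebra.IsKilling LieModule Module

variable {L : Type*} [LieRing L] [LieAlgebra ℂ L] [FiniteDimensional ℂ L]
  [LieAlgebra.IsKilling ℂ L] {H : LieSubalgebra ℂ L} [H.IsCartanSubalgebra]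

/-- A nonvanishing bracket along a root string. -/
lemma exists_lie_ne_zero (α β γ : Weight ℂ H L) (hα : α.IsNonZero)
    (hγ : (γ : H → ℂ) = α + β) :
    ∃ f ∈ rootSpace H (-α : H → ℂ), ∃ x ∈ rootSpace H (γ : H → ℂ),
      ⁅f, x⁆ ∈ rootSpace H (β : H → ℂ) ∧ ⁅f, x⁆ ≠ 0 := by
  obtain ⟨x, hx, x_ne0⟩ := (chainTop α β).exists_ne_zero
  obtain ⟨h, e, f, isSl2, he, hf⟩ := exists_isSl2Triple_of_weight_isNonZero hα
  obtain rfl := isSl2.h_eq_coroot hα he hf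
  have prim : isSl2.HasPrimitiveVectorWith x (chainLength α β : ℂ) :=
    have := lie_mem_genWeightSpace_of_mem_genWeightSpace he hx
    ⟨x_ne0, (chainLength_smul _ _ hx).symm, by rwa [genWeightSpace_add_chainTop _ _ hα] at this⟩
  have h1 : 1 ≤ chainTopCoeff α β := by
    have := ((rootSpace_zsmul_add_ne_bot_iff α β hα 1).mp (by
      rw [one_smul, ← hγ]; exact γ.2)).1
    exact_mod_cast this
  obtain ⟨m, hm⟩ := Nat.exists_eq_add_of_le' h1
  have hne := prim.pow_toEnd_f_ne_zero_of_eq_nat rfl (chainTopCoeff_le_chainLength α β)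
  rw [hm, ← prim.lie_f_pow_toEnd_f] at hne
  have hmem : ((toEnd ℂ L L f) ^ m) x ∈ rootSpace H (γ : H → ℂ) := by
    have := toEnd_pow_apply_mem hf hx m
    convert this using 2
    rw [hγ, coe_chainTop', hm, add_smul]
    simp only [one_smul, smul_neg]
    abel
  refine ⟨f, hf, _, hmem, ?_, hne⟩
  have := lie_mem_genWeightSpace_of_mem_genWeightSpace hf hmem
  rwa [hγ, neg_add_cancel_left] at this

/-- The two pieces of the decomposition, indexed by parity. -/
def V (K : LieSubalgebra ℂ L) (P : Submodule ℂ L) (a : ZMod 2) : Submodule ℂ L :=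
  if a = 0 then K.toSubmodule else P

lemma zmod_cases (a : ZMod 2) : a = 0 ∨ a = 1 := by revert a; decide

section
variable (K : LieSubalgebra ℂ L) (P : Submodule ℂ L)
    (hdec : IsCompl K.toSubmodule P)
    (hKP : ∀ x ∈ K, ∀ y ∈ P, ⁅x, y⁆ ∈ P)
    (hPP : ∀ x ∈ P, ∀ y ∈ P, ⁅x, y⁆ ∈ K)
    (hHK : H ≤ K)

omit [FiniteDimensional ℂ L] [IsKilling ℂ L] in
include hKP hPP in
lemma V_lie (a b : ZMod 2) (x y : L) (hx : x ∈ V K P a) (hy : y ∈ V K P b) :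
    ⁅x, y⁆ ∈ V K P (a + b) := by
  have h11 : (1 : ZMod 2) + 1 = 0 := by decide
  obtain rfl | rfl := zmod_cases a <;> obtain rfl | rfl := zmod_cases b <;>
    simp [V, h11] at hx hy ⊢
  · exact K.lie_mem hx hy
  · exact hKP _ hx _ hy
  · rw [← lie_skew]; exact neg_mem (hKP _ hy _ hx)
  · exact hPP _ hx _ hy

omit [FiniteDimensional ℂ L] [IsKilling ℂ L] in
include hdec in
lemma V_inj (a b : ZMod 2) (x : L) (hx : x ∈ V K P a) (hy : x ∈ V K P b) (h0 : x ≠ 0) :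
    a = b := by
  have key : ∀ x, x ∈ K → x ∈ P → x = 0 := fun x h1 h2 =>
    Submodule.disjoint_def.mp hdec.disjoint x h1 h2
  obtain rfl | rfl := zmod_cases a <;> obtain rfl | rfl := zmod_cases b <;>
    simp [V] at hx hy ⊢
  · exact h0 (key x hx hy)
  · exact h0 (key x hy hx)

include hdec hKP hHK in
lemma exists_parity (α : Weight ℂ H L) (hα : α.IsNonZero) :
    ∃ a, (rootSpace H (α : H → ℂ) : Submodule ℂ L) ≤ V K P a := by
  obtain ⟨x, hx, hx0⟩ := α.exists_ne_zero
  have hspan : ∀ z ∈ rootSpace H (α : H → ℂ), ∀ y ∈ rootSpace H (α : H → ℂ), z ≠ 0 →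
      ∃ c : ℂ, c • z = y := by
    intro z hz y hy hz0
    simpa using (finrank_eq_one_iff_of_nonzero' ⟨z, hz⟩ (by simpa using hz0)).mp
      (finrank_rootSpace_eq_one _ hα) ⟨y, hy⟩
  obtain ⟨k, hk, p, hp, hkp⟩ := Submodule.mem_sup.mp
    (hdec.sup_eq_top ▸ Submodule.mem_top : x ∈ K.toSubmodule ⊔ P)
  have hker : ∀ h : H, ⁅h, k⁆ = α h • k ∧ ⁅h, p⁆ = α h • p := by
    intro h
    have e : ⁅h, x⁆ = α h • x := lie_eq_smul_of_mem_rootSpace hx h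
    rw [← hkp, lie_add, smul_add] at e
    have e1 : ⁅h, k⁆ - α h • k = α h • p - ⁅h, p⁆ := by
      rw [sub_eq_sub_iff_add_eq_add, e]; abel
    have m1 : ⁅h, k⁆ - α h • k ∈ K.toSubmodule :=
      sub_mem (K.lie_mem (hHK h.2) hk) (Submodule.smul_mem _ _ hk)
    have m2 : α h • p - ⁅h, p⁆ ∈ P :=
      sub_mem (Submodule.smul_mem _ _ hp) (hKP _ (hHK h.2) _ hp)
    have z := Submodule.disjoint_def.mp hdec.disjoint _ m1 (e1 ▸ m2)
    refine ⟨sub_eq_zero.mp z, ?_⟩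
    rw [z] at e1
    exact (sub_eq_zero.mp e1.symm).symm
  have hmem : ∀ y : L, (∀ h : H, ⁅h, y⁆ = α h • y) → y ∈ rootSpace H (α : H → ℂ) := by
    intro y hy
    exact weightSpace_le_genWeightSpace L α ((mem_weightSpace _ _).mpr hy)
  by_cases hk0 : k = 0
  · refine ⟨1, fun y hy => ?_⟩
    have : x = p := by rw [← hkp, hk0, zero_add]
    obtain ⟨c, rfl⟩ := hspan x hx y hy hx0
    exact Submodule.smul_mem _ _ (by simpa [V, this] using hp)
  · refine ⟨0, fun y hy => ?_⟩
    obtain ⟨c, rfl⟩ := hspan k (hmem k fun h => (hker h).1) y hy hk0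
    exact Submodule.smul_mem _ _ (by simpa [V] using hk)

include hdec hKP hPP hHK in
lemma exists_coweight : ∃ h : H, ∀ α : H → ℂ, α ≠ 0 → rootSpace H α ≠ ⊥ →
    ∃ n : ℤ, α h = n ∧
      ((rootSpace H α : Submodule ℂ L) ≤ K.toSubmodule → (n : ZMod 2) = 0) ∧
      ((rootSpace H α : Submodule ℂ L) ≤ P → (n : ZMod 2) = 1) := by
  classical
  have hpar : ∀ α : H.root, ∃ a, (rootSpace H (α.1 : H → ℂ) : Submodule ℂ L) ≤ V K P a :=
    fun α => exists_parity K P hdec hKP hHK α.1 (H.isNonZero_coe_root α)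
  choose c hc using hpar
  have hneg : ∀ α β : H.root, (β.1 : H → ℂ) = -α.1 → c β = c α := by
    intro α β hβ
    obtain ⟨h, e, f, t, he, hf⟩ :=
      exists_isSl2Triple_of_weight_isNonZero (α := α.1) (H := H) (H.isNonZero_coe_root α)
    have h0 : ⁅e, f⁆ ∈ V K P 0 := by
      rw [t.lie_e_f, t.h_eq_coroot (H.isNonZero_coe_root α) he hf]
      simpa [V] using hHK (coroot α.1).2
    have h1 := V_lie K P hKP hPP _ _ e f (hc α he) (hc β (by rw [hβ]; exact hf))
    have h2 := V_inj K P hdec _ _ _ h0 h1 (by rw [t.lie_e_f]; exact t.h_ne_zero)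
    clear h0 h1
    revert h2
    generalize c α = a
    generalize c β = b
    revert a b; decide
  have hadd : ∀ α β γ : H.root, (γ.1 : H → ℂ) = α.1 + β.1 → c γ = c α + c β := by
    intro α β γ hγ
    obtain ⟨f, hf, x, hx, hm, h0⟩ := exists_lie_ne_zero α.1 β.1 γ.1 (H.isNonZero_coe_root α) hγ
    let ν : H.root := ⟨-α.1, by
      simpa using H.isNonZero_coe_root α⟩
    have h1 := V_lie K P hKP hPP _ _ f x (hc ν hf) (hc γ hx)
    have h2 := V_inj K P hdec _ _ _ (hc β hm) h1 h0
    rw [hneg α ν rfl] at h2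
    rw [h2]
    generalize c α = a
    generalize c γ = b
    revert a b; decide
  obtain ⟨b⟩ := (rootSystem H).nonempty_base
  let φ : Dual ℂ (Dual ℂ H) := b.toWeightBasis.constr ℂ (fun i => ((c i).val : ℂ))
  let h : H := (Module.evalEquiv ℂ H).symm φ
  have hh : ∀ g : Dual ℂ H, g h = φ g := fun g => by
    simp [h]
  have hb : ∀ i ∈ b.support, (i.1 : H → ℂ) h = (c i).val := by
    intro i hi
    have := hh ((rootSystem H).root i)
    rw [show (rootSystem H).root i = b.toWeightBasis ⟨i, hi⟩ by simp, Basis.constr_basis] at this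
    simpa using this
  have main : ∀ i : H.root, ∃ n : ℤ, (i.1 : H → ℂ) h = n ∧ (n : ZMod 2) = c i := by
    intro i
    refine b.induction_add i (p := fun i => ∃ n : ℤ, (i.1 : H → ℂ) h = n ∧ (n : ZMod 2) = c i)
      ?_ ?_ ?_
    · rintro i ⟨n, hn, hn'⟩
      have hr : ((((rootSystem H).reflectionPerm i i).1 : Weight ℂ H L) : H → ℂ) = -i.1 := by
        have := (rootSystem H).root_reflectionPerm i i
        rw [RootPairing.reflection_apply_self] at this
        funext y
        exact LinearMap.congr_fun this y
      refine ⟨-n, by rw [hr, Pi.neg_apply, hn]; simp, ?_⟩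
      rw [hneg i _ hr, ← hn']
      push_cast
      exact ZMod.neg_eq_self_mod_two _
    · intro i hi
      exact ⟨(c i).val, by simp [hb i hi], by simp⟩
    · rintro i j k hk ⟨n, hn, hn'⟩ hj
      have hr : (k.1 : H → ℂ) = i.1 + j.1 := by
        funext y
        simpa using LinearMap.congr_fun hk y
      refine ⟨n + (c j).val, by rw [hr, Pi.add_apply, hn, hb j hj]; simp, ?_⟩
      rw [hadd i j k hr, ← hn']; simp
  refine ⟨h, fun α h0 hbot => ?_⟩
  let w : Weight ℂ H L := ⟨α, hbot⟩
  have hw : w.IsNonZero := fun hz => h0 hz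
  let r : H.root := ⟨w, by simpa using hw⟩
  obtain ⟨n, hn, hn'⟩ := main r
  obtain ⟨x, hx, hx0⟩ := w.exists_ne_zero
  refine ⟨n, hn, fun hK => ?_, fun hP => ?_⟩
  · rw [hn']
    exact V_inj K P hdec _ _ x (hc r hx) (by simpa [V] using hK hx) hx0
  · rw [hn']
    exact V_inj K P hdec _ _ x (hc r hx) (by simpa [V] using hP hx) hx0

end

end Stmt2Aux

/-- The function assigning `0` to compact roots and `1` to noncompact roots extends to a
group homomorphism from the root lattice `ℤΦ` to `ℤ/2ℤ`; consequently no noncompact root is a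
`ℤ`-linear combination of compact roots. -/
theorem stmt2
    {L : Type*} [LieRing L] [LieAlgebra ℂ L] [FiniteDimensional ℂ L]
    [LieAlgebra.IsSemisimple ℂ L]
    (K : LieSubalgebra ℂ L) (P : Submodule ℂ L)
    (hdec : IsCompl K.toSubmodule P)
    (hKP : ∀ x ∈ K, ∀ y ∈ P, ⁅x, y⁆ ∈ P)
    (hPP : ∀ x ∈ P, ∀ y ∈ P, ⁅x, y⁆ ∈ K)
    (H : LieSubalgebra ℂ L) [H.IsCartanSubalgebra] (hHK : H ≤ K) :
    (∃ f : AddSubgroup.closure {α : H → ℂ | α ≠ 0 ∧ LieAlgebra.rootSpace H α ≠ ⊥} →+ ZMod 2,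
      ∀ α : H → ℂ, ∀ hα : α ≠ 0 ∧ LieAlgebra.rootSpace H α ≠ ⊥,
        ((LieAlgebra.rootSpace H α : Submodule ℂ L) ≤ K.toSubmodule →
          f ⟨α, AddSubgroup.subset_closure hα⟩ = 0) ∧
        ((LieAlgebra.rootSpace H α : Submodule ℂ L) ≤ P →
          f ⟨α, AddSubgroup.subset_closure hα⟩ = 1)) ∧
    (∀ α : H → ℂ, α ≠ 0 → LieAlgebra.rootSpace H α ≠ ⊥ →
      (LieAlgebra.rootSpace H α : Submodule ℂ L) ≤ P →
      α ∉ AddSubgroup.closure {β : H → ℂ | β ≠ 0 ∧ LieAlgebra.rootSpace H β ≠ ⊥ ∧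
        (LieAlgebra.rootSpace H β : Submodule ℂ L) ≤ K.toSubmodule}) := by
  obtain ⟨h, hh⟩ := Stmt2Aux.exists_coweight K P hdec hKP hPP hHK
  have hcl : ∀ x ∈ AddSubgroup.closure {α : H → ℂ | α ≠ 0 ∧ LieAlgebra.rootSpace H α ≠ ⊥},
      ∃ n : ℤ, x h = n := by
    intro x hx
    induction hx using AddSubgroup.closure_induction with
    | mem x hx => obtain ⟨n, hn, -⟩ := hh x hx.1 hx.2; exact ⟨n, hn⟩
    | zero => exact ⟨0, by simp⟩
    | add x y _ _ ihx ihy =>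
      obtain ⟨n, hn⟩ := ihx
      obtain ⟨m, hm⟩ := ihy
      exact ⟨n + m, by simp [hn, hm]⟩
    | neg x _ ihx =>
      obtain ⟨n, hn⟩ := ihx
      exact ⟨-n, by simp [hn]⟩
  refine ⟨?_, ?_⟩
  · choose F hF using fun x : AddSubgroup.closure
      {α : H → ℂ | α ≠ 0 ∧ LieAlgebra.rootSpace H α ≠ ⊥} => hcl x.1 x.2
    have hFadd : ∀ x y, F (x + y) = F x + F y := by
      intro x y
      have : ((F (x + y) : ℤ) : ℂ) = ((F x + F y : ℤ) : ℂ) := by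
        rw [← hF]; push_cast; rw [← hF, ← hF]; rfl
      exact_mod_cast this
    refine ⟨AddMonoidHom.mk' (fun x => (F x : ZMod 2))
      (fun x y => by simp [hFadd]), fun α hα => ?_⟩
    obtain ⟨n, hn, h1, h2⟩ := hh α hα.1 hα.2
    have : F ⟨α, AddSubgroup.subset_closure hα⟩ = n := by
      have e := hF ⟨α, AddSubgroup.subset_closure hα⟩
      replace e : α h = _ := e
      rw [hn] at e
      exact_mod_cast e.symm
    simp only [AddMonoidHom.mk'_apply, this]
    exact ⟨h1, h2⟩
  · intro α h0 hbot hP hmem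
    have hev : ∀ x ∈ AddSubgroup.closure {β : H → ℂ | β ≠ 0 ∧ LieAlgebra.rootSpace H β ≠ ⊥ ∧
        (LieAlgebra.rootSpace H β : Submodule ℂ L) ≤ K.toSubmodule},
        ∃ n : ℤ, x h = n ∧ (n : ZMod 2) = 0 := by
      intro x hx
      induction hx using AddSubgroup.closure_induction with
      | mem x hx =>
        obtain ⟨n, hn, h1, -⟩ := hh x hx.1 hx.2.1
        exact ⟨n, hn, h1 hx.2.2⟩
      | zero => exact ⟨0, by simp⟩
      | add x y _ _ ihx ihy =>
        obtain ⟨n, hn, hn'⟩ := ihx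
        obtain ⟨m, hm, hm'⟩ := ihy
        exact ⟨n + m, by simp [hn, hm], by simp [hn', hm']⟩
      | neg x _ ihx =>
        obtain ⟨n, hn, hn'⟩ := ihx
        exact ⟨-n, by simp [hn], by simp [hn']⟩
    obtain ⟨n, hn, hn'⟩ := hev α hmem
    obtain ⟨m, hm, -, hm'⟩ := hh α h0 hbot
    have : n = m := by
      rw [hn] at hm
      exact_mod_cast hm
    subst this
    rw [hm' hP] at hn'
    exact one_ne_zero hn'
end
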